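/- (Brink–Howlett) For every Coxeter system (W, S) with S finite, the set Σ of small roots is finite. -/

import Mathlib

section RootSystemDefs

variable {S : Type*} {W : Type*} [Group W]

/-- The simple root `α_s` in the vector space `V = S → ℝ`. -/
def simpleRoot [DecidableEq S] (s : S) : S → ℝ := Pi.single s 1

/-- The symmetric bilinear form `B` on `V = S → ℝ` with `B(α_s, α_t) = -cos (π / m s t)`
(with the convention that `B(α_s, α_t) = -1` when `m s t = ∞`, which is encoded by
`Mmat s t = 0`). -/
noncomputable def bform [Fintype S] (Mmat : CoxeterMatrix S) (v u : S → ℝ) : ℝ :=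
  ∑ s : S, ∑ t : S,
    v s * u t * (if Mmat s t = 0 then -1 else -Real.cos (Real.pi / (Mmat s t : ℝ)))

/-- The conic closure of `X`: all nonnegative linear combinations of elements of `X`. -/
def coneOf {V : Type*} [AddCommMonoid V] [Module ℝ V] (X : Set V) : Set V :=
  {v | ∃ (n : ℕ) (c : Fin n → ℝ) (x : Fin n → V),
    (∀ i, 0 ≤ c i) ∧ (∀ i, x i ∈ X) ∧ v = ∑ i, c i • x i}

variable [Fintype S] [DecidableEq S] {Mmat : CoxeterMatrix S}

/-- The root system `Φ = W(Δ)`, for the representation `ρ` of `W` on `V = S → ℝ`. -/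
def rootSet (ρ : W →* ((S → ℝ) ≃ₗ[ℝ] (S → ℝ))) : Set (S → ℝ) :=
  {v | ∃ (w : W) (s : S), v = ρ w (simpleRoot s)}

/-- The positive roots `Φ⁺ = cone(Δ) ∩ Φ`. -/
def posRoots (ρ : W →* ((S → ℝ) ≃ₗ[ℝ] (S → ℝ))) : Set (S → ℝ) :=
  coneOf (Set.range (simpleRoot (S := S))) ∩ rootSet ρ

/-- The negative roots `Φ⁻ = -Φ⁺`. -/
def negRoots (ρ : W →* ((S → ℝ) ≃ₗ[ℝ] (S → ℝ))) : Set (S → ℝ) :=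
  {v | -v ∈ posRoots ρ}

/-- Dominance order: `Dominates ρ a b` means `a ≼ b`, i.e. every `w ∈ W` sending `b` to a
negative root also sends `a` to a negative root. -/
def Dominates (ρ : W →* ((S → ℝ) ≃ₗ[ℝ] (S → ℝ))) (a b : S → ℝ) : Prop :=
  ∀ w : W, ρ w b ∈ negRoots ρ → ρ w a ∈ negRoots ρ

/-- A small root: a positive root dominating no positive root other than itself. -/
def IsSmallRoot (ρ : W →* ((S → ℝ) ≃ₗ[ℝ] (S → ℝ))) (b : S → ℝ) : Prop :=
  b ∈ posRoots ρ ∧ ∀ a ∈ posRoots ρ, Dominates ρ a b → a = b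

/-- `t : W` is the reflection `s_b` in the root `b`: it acts on `V` by
`v ↦ v - 2 B(b, v) b`. -/
def IsReflIn (Mmat : CoxeterMatrix S) (ρ : W →* ((S → ℝ) ≃ₗ[ℝ] (S → ℝ)))
    (t : W) (b : S → ℝ) : Prop :=
  ∀ v : S → ℝ, ρ t v = v - (2 * bform Mmat b v) • b

/-- The (left) inversion set `N(w) = Φ⁺ ∩ w(Φ⁻)`. -/
def invSet (ρ : W →* ((S → ℝ) ≃ₗ[ℝ] (S → ℝ))) (w : W) : Set (S → ℝ) :=
  {b | b ∈ posRoots ρ ∧ ρ w⁻¹ b ∈ negRoots ρ}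

/-- `N¹(w) = {α ∈ Φ⁺ : ℓ(s_α w) = ℓ(w) - 1}`. -/
def nOne (cs : CoxeterSystem Mmat W) (ρ : W →* ((S → ℝ) ≃ₗ[ℝ] (S → ℝ)))
    (w : W) : Set (S → ℝ) :=
  {b | b ∈ posRoots ρ ∧
    ∃ t : W, IsReflIn Mmat ρ t b ∧ cs.length (t * w) + 1 = cs.length w}

/-- A low element of `W`: an element `w` with `N¹(w) ⊆ Σ`. -/
def IsLow (cs : CoxeterSystem Mmat W) (ρ : W →* ((S → ℝ) ≃ₗ[ℝ] (S → ℝ)))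
    (w : W) : Prop :=
  ∀ b ∈ nOne cs ρ w, IsSmallRoot ρ b

end RootSystemDefs

section GeometricRepresentation

set_option linter.unusedSectionVars false

open CoxeterSystem

variable {S : Type*} [Fintype S] {Mmat : CoxeterMatrix S}

lemma bform_comm (v u : S → ℝ) : bform Mmat v u = bform Mmat u v := by
  unfold bform
  rw [Finset.sum_comm]
  refine Finset.sum_congr rfl fun s _ => Finset.sum_congr rfl fun t _ => ?_
  rw [Mmat.symmetric s t, mul_comm (v t)]

lemma bform_add_left (v v' u : S → ℝ) :
    bform Mmat (v + v') u = bform Mmat v u + bform Mmat v' u := by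
  simp only [bform, Pi.add_apply, add_mul, Finset.sum_add_distrib]

lemma bform_smul_left (c : ℝ) (v u : S → ℝ) :
    bform Mmat (c • v) u = c * bform Mmat v u := by
  simp only [bform, Pi.smul_apply, smul_eq_mul, Finset.mul_sum, mul_assoc]

lemma bform_neg_left (v u : S → ℝ) : bform Mmat (-v) u = -bform Mmat v u := by
  simpa using bform_smul_left (Mmat := Mmat) (-1) v u

lemma bform_sub_left (v v' u : S → ℝ) :
    bform Mmat (v - v') u = bform Mmat v u - bform Mmat v' u := by
  rw [sub_eq_add_neg, bform_add_left, bform_neg_left, ← sub_eq_add_neg]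

lemma bform_add_right (v u u' : S → ℝ) :
    bform Mmat v (u + u') = bform Mmat v u + bform Mmat v u' := by
  simp only [bform_comm v, bform_add_left]

lemma bform_smul_right (c : ℝ) (v u : S → ℝ) :
    bform Mmat v (c • u) = c * bform Mmat v u := by
  simp only [bform_comm v, bform_smul_left]

lemma bform_neg_right (v u : S → ℝ) : bform Mmat v (-u) = -bform Mmat v u := by
  simp only [bform_comm v, bform_neg_left]

lemma bform_sub_right (v u u' : S → ℝ) :
    bform Mmat v (u - u') = bform Mmat v u - bform Mmat v u' := by
  simp only [bform_comm v, bform_sub_left]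

variable [DecidableEq S]

lemma bform_eq_sum (v u : S → ℝ) :
    bform Mmat v u = ∑ s, v s * bform Mmat (simpleRoot s) u := by
  have (s : S) : bform Mmat (simpleRoot s) u =
      ∑ t, u t * (if Mmat s t = 0 then -1 else -Real.cos (Real.pi / (Mmat s t : ℝ))) := by
    simp only [bform, simpleRoot]
    rw [Finset.sum_eq_single s]
    · simp
    · intro x _ hx
      simp [Pi.single_eq_of_ne hx]
    · simp
  simp only [this, Finset.mul_sum]
  simp only [bform, mul_assoc]

lemma bform_simpleRoot (s t : S) : bform Mmat (simpleRoot s) (simpleRoot t) =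
    if Mmat s t = 0 then -1 else -Real.cos (Real.pi / (Mmat s t : ℝ)) := by
  simp only [bform, simpleRoot]
  rw [Finset.sum_eq_single s, Finset.sum_eq_single t]
  · simp
  · intro x _ hx
    simp [Pi.single_eq_of_ne hx]
  · simp
  · intro x _ hx
    simp [Pi.single_eq_of_ne hx]
  · simp

lemma bform_simpleRoot_self (s : S) : bform Mmat (simpleRoot s) (simpleRoot s) = 1 := by
  simp [bform_simpleRoot]

lemma bform_simpleRoot_nonpos {s t : S} (h : s ≠ t) :
    bform Mmat (simpleRoot s) (simpleRoot t) ≤ 0 := by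
  rw [bform_simpleRoot]
  split_ifs with h0
  · norm_num
  · have h1 := Mmat.off_diagonal s t h
    have h2 : (2 : ℝ) ≤ (Mmat s t : ℝ) := by
      have : 2 ≤ Mmat s t := by
        have : Mmat s t ≠ 1 := h1
        omega
      exact_mod_cast this
    have : 0 ≤ Real.cos (Real.pi / (Mmat s t : ℝ)) := by
      apply Real.cos_nonneg_of_neg_pi_div_two_le_of_le
      · have : 0 ≤ Real.pi / (Mmat s t : ℝ) := by positivity
        linarith [Real.pi_pos]
      · exact div_le_div_of_nonneg_left Real.pi_pos.le (by norm_num) h2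
    linarith

lemma simpleRoot_nonneg (s : S) : 0 ≤ simpleRoot s := by
  intro t
  unfold simpleRoot
  by_cases h : t = s
  · subst h; simp
  · simp [Pi.single_eq_of_ne h]

variable {W : Type*} [Group W]

/-- `ρ` is the standard geometric representation: each simple reflection `s` acts as the
`B`-reflection in `α_s`. -/
def IsGeometric (cs : CoxeterSystem Mmat W) (ρ : W →* ((S → ℝ) ≃ₗ[ℝ] (S → ℝ))) : Prop :=
  ∀ (s : S) (v : S → ℝ),
    ρ (cs.simple s) v = v - (2 * bform Mmat (simpleRoot s) v) • simpleRoot s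

variable {cs : CoxeterSystem Mmat W} {ρ : W →* ((S → ℝ) ≃ₗ[ℝ] (S → ℝ))}

lemma bform_map (h : IsGeometric cs ρ) (w : W) (v u : S → ℝ) :
    bform Mmat (ρ w v) (ρ w u) = bform Mmat v u := by
  induction w using cs.simple_induction generalizing v u with
  | simple s =>
    simp only [h s, bform_sub_left, bform_sub_right, bform_smul_left, bform_smul_right,
      bform_simpleRoot_self, bform_comm v (simpleRoot s)]
    ring
  | one => simp
  | mul w w' hw hw' => simp [hw, hw']

lemma map_simple_simpleRoot (h : IsGeometric cs ρ) (s : S) :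
    ρ (cs.simple s) (simpleRoot s) = -simpleRoot s := by
  rw [h, bform_simpleRoot_self]
  module

lemma simpleRoot_mem_rootSet (s : S) : simpleRoot s ∈ rootSet ρ := ⟨1, s, by simp⟩

lemma map_mem_rootSet {v : S → ℝ} (hv : v ∈ rootSet ρ) (w : W) : ρ w v ∈ rootSet ρ := by
  obtain ⟨u, s, rfl⟩ := hv
  exact ⟨w * u, s, by simp⟩

lemma neg_mem_rootSet (h : IsGeometric cs ρ) {v : S → ℝ} (hv : v ∈ rootSet ρ) :
    -v ∈ rootSet ρ := by
  obtain ⟨u, s, rfl⟩ := hv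
  exact ⟨u * cs.simple s, s, by simp [map_simple_simpleRoot h]⟩

lemma bform_self_of_mem_rootSet (h : IsGeometric cs ρ) {v : S → ℝ} (hv : v ∈ rootSet ρ) :
    bform Mmat v v = 1 := by
  obtain ⟨u, s, rfl⟩ := hv
  rw [bform_map h, bform_simpleRoot_self]

lemma exists_isReflIn (h : IsGeometric cs ρ) {v : S → ℝ} (hv : v ∈ rootSet ρ) :
    ∃ t, IsReflIn Mmat ρ t v := by
  obtain ⟨u, s, rfl⟩ := hv
  refine ⟨u * cs.simple s * u⁻¹, fun x => ?_⟩
  have hx : ρ u (ρ u⁻¹ x) = x := by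
    rw [← LinearEquiv.mul_apply, ← map_mul]
    simp
  have hb : bform Mmat (ρ u (simpleRoot s)) x = bform Mmat (simpleRoot s) (ρ u⁻¹ x) := by
    rw [← bform_map h u (simpleRoot s), hx]
  simp only [map_mul, LinearEquiv.mul_apply]
  rw [h s, hb, map_sub, map_smul, hx]

lemma mem_coneOf_simpleRoot {v : S → ℝ} :
    v ∈ coneOf (Set.range (simpleRoot (S := S))) ↔ 0 ≤ v := by
  constructor
  · rintro ⟨n, c, x, hc, hx, rfl⟩
    refine Finset.sum_nonneg fun i _ => smul_nonneg (hc i) ?_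
    obtain ⟨s, hs⟩ := hx i
    exact hs ▸ simpleRoot_nonneg s
  · intro hv
    let e := Fintype.equivFin S
    refine ⟨Fintype.card S, fun i => v (e.symm i), fun i => simpleRoot (e.symm i),
      fun i => hv _, fun i => ⟨_, rfl⟩, ?_⟩
    rw [e.symm.sum_comp (fun s => v s • simpleRoot s)]
    ext t
    simp [simpleRoot, Finset.sum_apply, Pi.single_apply]

lemma mem_posRoots {v : S → ℝ} : v ∈ posRoots ρ ↔ 0 ≤ v ∧ v ∈ rootSet ρ := by
  rw [posRoots, Set.mem_inter_iff, mem_coneOf_simpleRoot]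

/-- The second-kind Chebyshev recursion `U 0 = 0`, `U 1 = 1`, `U (n + 2) = 2 c U (n + 1) - U n`. -/
def dihedralCoeff (c : ℝ) : ℕ → ℝ
  | 0 => 0
  | 1 => 1
  | n + 2 => 2 * c * dihedralCoeff c (n + 1) - dihedralCoeff c n

lemma dihedralCoeff_one (n : ℕ) : dihedralCoeff 1 n = n := by
  induction n using Nat.twoStepInduction with
  | zero => simp [dihedralCoeff]
  | one => simp [dihedralCoeff]
  | more n h1 h2 => rw [dihedralCoeff, h1, h2]; push_cast; ring

lemma sin_mul_dihedralCoeff_cos (θ : ℝ) (n : ℕ) :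
    Real.sin θ * dihedralCoeff (Real.cos θ) n = Real.sin (n * θ) := by
  induction n using Nat.twoStepInduction with
  | zero => simp [dihedralCoeff]
  | one => simp [dihedralCoeff]
  | more n h1 h2 =>
    rw [dihedralCoeff]
    have e1 : ((n + 2 : ℕ) : ℝ) * θ = (n + 1 : ℕ) * θ + θ := by push_cast; ring
    have e2 : (n : ℝ) * θ = (n + 1 : ℕ) * θ - θ := by push_cast; ring
    rw [e1, Real.sin_add]
    rw [e2, Real.sin_sub] at h1
    linear_combination 2 * Real.cos θ * h2 - h1

lemma dihedralCoeff_nonneg {s t : S} (hst : s ≠ t) {k : ℕ}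
    (hk : Mmat s t = 0 ∨ k ≤ Mmat s t) :
    0 ≤ dihedralCoeff (-bform Mmat (simpleRoot s) (simpleRoot t)) k := by
  rw [bform_simpleRoot]
  split_ifs with h0
  · simp [dihedralCoeff_one]
  · have hk := hk.resolve_left h0
    rw [neg_neg]
    have h1 : Mmat s t ≠ 1 := Mmat.off_diagonal s t hst
    have h2 : (2 : ℝ) ≤ (Mmat s t : ℝ) := by
      exact_mod_cast (show 2 ≤ Mmat s t by omega)
    set m : ℝ := (Mmat s t : ℝ) with hm
    have hkm : (k : ℝ) ≤ m := by rw [hm]; exact_mod_cast hk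
    have hpos : 0 < Real.sin (Real.pi / m) := by
      apply Real.sin_pos_of_pos_of_lt_pi
      · have := Real.pi_pos; positivity
      · exact div_lt_self Real.pi_pos (by linarith)
    have hnn : 0 ≤ Real.sin (k * (Real.pi / m)) := by
      apply Real.sin_nonneg_of_nonneg_of_le_pi
      · have := Real.pi_pos; positivity
      · rw [← mul_div_assoc, div_le_iff₀ (by linarith)]
        nlinarith [Real.pi_pos]
    rw [← sin_mul_dihedralCoeff_cos] at hnn
    exact nonneg_of_mul_nonneg_right hnn hpos

lemma map_alternatingWord_simpleRoot (h : IsGeometric cs ρ) (s t : S) (k : ℕ) :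
    ρ (cs.wordProd (alternatingWord s t k)) (simpleRoot s) =
      if Even k then
        dihedralCoeff (-bform Mmat (simpleRoot s) (simpleRoot t)) (k + 1) • simpleRoot s +
          dihedralCoeff (-bform Mmat (simpleRoot s) (simpleRoot t)) k • simpleRoot t
      else
        dihedralCoeff (-bform Mmat (simpleRoot s) (simpleRoot t)) k • simpleRoot s +
          dihedralCoeff (-bform Mmat (simpleRoot s) (simpleRoot t)) (k + 1) • simpleRoot t := by
  induction k using Nat.twoStepInduction generalizing s t with
  | zero => simp [alternatingWord, dihedralCoeff]
  | one =>
    simp only [alternatingWord, List.concat_eq_append, List.nil_append, wordProd_singleton, h t,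
      dihedralCoeff, bform_comm (simpleRoot t) (simpleRoot s)]
    rw [if_neg (by decide)]
    module
  | more k h1 h2 =>
    have e : ρ (cs.wordProd (alternatingWord s t (k + 2))) (simpleRoot s) =
        (-2 * bform Mmat (simpleRoot s) (simpleRoot t)) •
          ρ (cs.wordProd (alternatingWord t s (k + 1))) (simpleRoot t) -
        ρ (cs.wordProd (alternatingWord s t k)) (simpleRoot s) := by
      have e1 : ρ (cs.wordProd (alternatingWord t s (k + 1))) (simpleRoot s) =
          -ρ (cs.wordProd (alternatingWord s t k)) (simpleRoot s) := by
        rw [alternatingWord_succ, List.concat_eq_append, wordProd_append, wordProd_singleton,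
          map_mul, LinearEquiv.mul_apply, map_simple_simpleRoot h, map_neg]
      rw [alternatingWord_succ, List.concat_eq_append, wordProd_append, wordProd_singleton,
        map_mul, LinearEquiv.mul_apply, h t, map_sub, map_smul, e1,
        bform_comm (simpleRoot t) (simpleRoot s)]
      module
    rw [e, h1, h2, bform_comm (simpleRoot t) (simpleRoot s)]
    by_cases hk : Even k
    · have hk1 : ¬ Even (k + 1) := by simpa [Nat.even_add_one] using hk
      have hk2 : Even (k + 2) := by simpa [Nat.even_add_one] using hk
      rw [if_pos hk, if_neg hk1, if_pos hk2]
      simp only [dihedralCoeff]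
      module
    · have hk1 : Even (k + 1) := by simpa [Nat.even_add_one] using hk
      have hk2 : ¬ Even (k + 2) := by simpa [Nat.even_add_one] using hk
      rw [if_neg hk, if_pos hk1, if_neg hk2]
      simp only [dihedralCoeff]
      module

/-- If `ℓ(ws) > ℓ(w)` then `w(α_s)` has nonnegative coordinates. -/
lemma map_simpleRoot_nonneg (h : IsGeometric cs ρ) (w : W) (s : S)
    (hs : ¬ cs.IsRightDescent w s) : 0 ≤ ρ w (simpleRoot s) := by
  induction hn : cs.length w using Nat.strong_induction_on generalizing w s with
  | _ n ih =>
  by_cases hw : w = 1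
  · subst hw
    simpa using simpleRoot_nonneg s
  obtain ⟨t, ht⟩ := cs.exists_rightDescent_of_ne_one hw
  have hst : s ≠ t := by rintro rfl; exact hs ht
  let a : ℕ → W := fun k => cs.wordProd (alternatingWord s t k)
  have ha : ∀ k, cs.length (a k) ≤ k := fun k => by
    simpa using cs.length_wordProd_le (alternatingWord s t k)
  have hlow : ∀ k, cs.length w ≤ cs.length (w * (a k)⁻¹) + k := fun k => by
    have := cs.length_le_length_mul_add_right w (a k)⁻¹
    rw [cs.length_inv] at this
    exact this.trans (Nat.add_le_add_left (ha k) _)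
  let x : ℕ → S := fun k => if Even k then t else s
  have hax : ∀ k, w * (a (k + 1))⁻¹ = w * (a k)⁻¹ * cs.simple (x k) := fun k => by
    simp only [a, x, alternatingWord_succ', wordProd_cons, mul_inv_rev, cs.inv_simple, mul_assoc]
  let P : ℕ → Prop := fun k => cs.length (w * (a k)⁻¹) + k = cs.length w
  have hPdown : ∀ k, P (k + 1) → P k := fun k hk => by
    have h1 := hlow k
    have h2 := cs.length_mul_simple (w * (a k)⁻¹) (x k)
    rw [← hax] at h2
    simp only [P] at hk ⊢
    omega
  have hP1 : P 1 := by
    have := cs.isRightDescent_iff.mp ht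
    simpa [P, a, alternatingWord] using this
  classical
  let k := Nat.findGreatest P (cs.length w)
  have hlen : 1 ≤ cs.length w := by
    simp only [P] at hP1
    omega
  have hPk : P k := Nat.findGreatest_spec hlen hP1
  have hk1 : 1 ≤ k := Nat.le_findGreatest hlen hP1
  have hPk1 : ¬ P (k + 1) := by
    intro hP
    have hle : k + 1 ≤ cs.length w := by
      simp only [P] at hP
      omega
    exact Nat.findGreatest_is_greatest (Nat.lt_succ_self k) hle hP
  have hbound : Mmat s t = 0 ∨ k + 1 ≤ Mmat s t := by
    by_contra! hcon
    obtain ⟨h0, hcon⟩ := hcon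
    have hPm : P (Mmat s t) := by
      refine Nat.decreasingInduction' (P := P) (fun j _ _ hj => hPdown j hj)
        (show Mmat s t ≤ k by omega) hPk
    have hbraid : a (Mmat s t) =
        cs.wordProd (alternatingWord s t (Mmat s t - 1)) * cs.simple s := by
      have := cs.wordProd_braidWord_eq s t
      simp only [a]
      rw [braidWord, braidWord, Mmat.symmetric t s] at this
      rw [this]
      obtain ⟨m, hm⟩ := Nat.exists_eq_succ_of_ne_zero h0
      rw [hm, Nat.succ_eq_add_one, alternatingWord_succ, List.concat_eq_append, wordProd_append,
        wordProd_singleton, Nat.add_sub_cancel]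
    have hws : w * cs.simple s =
        w * (a (Mmat s t))⁻¹ * cs.wordProd (alternatingWord s t (Mmat s t - 1)) := by
      rw [hbraid, mul_inv_rev, cs.inv_simple]
      group
    have h1 := cs.length_mul_le (w * (a (Mmat s t))⁻¹)
      (cs.wordProd (alternatingWord s t (Mmat s t - 1)))
    have h2 := cs.length_wordProd_le (alternatingWord s t (Mmat s t - 1))
    rw [length_alternatingWord] at h2
    rw [← hws] at h1
    have h3 := cs.not_isRightDescent_iff.mp hs
    simp only [P] at hPm
    omega
  set v := w * (a k)⁻¹ with hv
  have hvk : cs.length v + k = cs.length w := hPk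
  have hvlen : cs.length v < n := by omega
  have hxv : ¬ cs.IsRightDescent v (x k) := by
    intro hd
    have := cs.isRightDescent_iff.mp hd
    rw [hv, ← hax] at this
    refine hPk1 (show cs.length (w * (a (k + 1))⁻¹) + (k + 1) = cs.length w from ?_)
    omega
  have hyv : ¬ cs.IsRightDescent v (x (k - 1)) := by
    intro hd
    have := cs.isRightDescent_iff.mp hd
    obtain ⟨j, hj⟩ : ∃ j, k = j + 1 := ⟨k - 1, by omega⟩
    have e : v * cs.simple (x (k - 1)) = w * (a j)⁻¹ := by
      rw [hv, hj, hax, Nat.add_sub_cancel]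
      simp
    have h1 := hlow j
    rw [e] at this
    omega
  have hboth : ¬ cs.IsRightDescent v s ∧ ¬ cs.IsRightDescent v t := by
    obtain ⟨j, hj⟩ : ∃ j, k = j + 1 := ⟨k - 1, by omega⟩
    rw [hj, Nat.add_sub_cancel] at hyv
    rw [hj] at hxv
    simp only [x, Nat.even_add_one] at hxv hyv
    by_cases he : Even j
    · simp only [he, not_true_eq_false, if_false, if_true] at hxv hyv
      exact ⟨hxv, hyv⟩
    · simp only [he, not_false_eq_true, if_false, if_true] at hxv hyv
      exact ⟨hyv, hxv⟩
  have hvs := ih _ hvlen v s hboth.1 rfl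
  have hvt := ih _ hvlen v t hboth.2 rfl
  have hwva : w = v * a k := by rw [hv]; simp
  have hc1 := dihedralCoeff_nonneg (Mmat := Mmat) hst (k := k + 1) hbound
  have hc0 := dihedralCoeff_nonneg (Mmat := Mmat) hst (k := k) (hbound.imp_right (by omega))
  rw [hwva, map_mul, LinearEquiv.mul_apply, map_alternatingWord_simpleRoot h]
  split_ifs
  · rw [map_add, map_smul, map_smul]
    exact add_nonneg (smul_nonneg hc1 hvs) (smul_nonneg hc0 hvt)
  · rw [map_add, map_smul, map_smul]
    exact add_nonneg (smul_nonneg hc0 hvs) (smul_nonneg hc1 hvt)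

lemma nonneg_or_nonpos_of_mem_rootSet (h : IsGeometric cs ρ) {v : S → ℝ}
    (hv : v ∈ rootSet ρ) : 0 ≤ v ∨ v ≤ 0 := by
  obtain ⟨w, s, rfl⟩ := hv
  by_cases hs : cs.IsRightDescent w s
  · right
    have := map_simpleRoot_nonneg h _ _ (cs.isRightDescent_iff_not_isRightDescent_mul.mp hs)
    rw [map_mul, LinearEquiv.mul_apply, map_simple_simpleRoot h, map_neg] at this
    exact neg_nonneg.mp this
  · exact Or.inl (map_simpleRoot_nonneg h _ _ hs)

/-- The height of a vector: the sum of its coordinates in the basis of simple roots. -/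
def height (S : Type*) [Fintype S] : (S → ℝ) →ₗ[ℝ] ℝ := ∑ s, LinearMap.proj s

lemma height_apply (v : S → ℝ) : height S v = ∑ s, v s := by
  simp [height]

lemma height_simpleRoot (s : S) : height S (simpleRoot s) = 1 := by
  simp [height_apply, simpleRoot]

lemma ne_zero_of_mem_rootSet (h : IsGeometric cs ρ) {v : S → ℝ} (hv : v ∈ rootSet ρ) :
    v ≠ 0 := by
  rintro rfl
  have := bform_self_of_mem_rootSet h hv
  simp [bform] at this

lemma height_pos (h : IsGeometric cs ρ) {v : S → ℝ} (hv : v ∈ posRoots ρ) :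
    0 < height S v := by
  obtain ⟨hv0, hv⟩ := mem_posRoots.mp hv
  rw [height_apply]
  obtain ⟨s, hs⟩ := Function.ne_iff.mp (ne_zero_of_mem_rootSet h hv)
  exact Finset.sum_pos' (fun t _ => hv0 t) ⟨s, Finset.mem_univ s, lt_of_le_of_ne (hv0 s) hs.symm⟩

lemma mem_posRoots_or_mem_negRoots (h : IsGeometric cs ρ) {v : S → ℝ} (hv : v ∈ rootSet ρ) :
    v ∈ posRoots ρ ∨ v ∈ negRoots ρ := by
  rcases nonneg_or_nonpos_of_mem_rootSet h hv with h0 | h0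
  · exact Or.inl (mem_posRoots.mpr ⟨h0, hv⟩)
  · exact Or.inr (mem_posRoots.mpr ⟨neg_nonneg.mpr h0, neg_mem_rootSet h hv⟩)

lemma not_mem_negRoots (h : IsGeometric cs ρ) {v : S → ℝ} (hv : v ∈ posRoots ρ) :
    v ∉ negRoots ρ := by
  intro hn
  have h1 := height_pos h hv
  have h2 := height_pos h (v := -v) hn
  rw [map_neg] at h2
  linarith

lemma simpleRoot_mem_posRoots (s : S) : simpleRoot s ∈ posRoots ρ :=
  mem_posRoots.mpr ⟨simpleRoot_nonneg s, simpleRoot_mem_rootSet s⟩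

/-- A simple reflection `s` permutes the positive roots other than `α_s`. -/
lemma map_simple_mem_posRoots (h : IsGeometric cs ρ) {v : S → ℝ} (hv : v ∈ posRoots ρ) {s : S}
    (hs : v ≠ simpleRoot s) : ρ (cs.simple s) v ∈ posRoots ρ := by
  have hroot := (mem_posRoots.mp hv).2
  have hv0 := (mem_posRoots.mp hv).1
  have hmem := map_mem_rootSet hroot (cs.simple s)
  refine (mem_posRoots_or_mem_negRoots h hmem).resolve_right fun hn => hs ?_
  have hle : 0 ≤ -ρ (cs.simple s) v := (mem_posRoots.mp hn).1
  have hzero : ∀ t, t ≠ s → v t = 0 := by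
    intro t ht
    have h1 := hle t
    rw [h] at h1
    simp only [simpleRoot, Pi.zero_apply, Pi.neg_apply, Pi.sub_apply, Pi.smul_apply,
      Pi.single_eq_of_ne ht, smul_zero, sub_zero] at h1
    have h2 : 0 ≤ v t := hv0 t
    linarith
  have hvs : v = v s • simpleRoot s := by
    ext t
    by_cases ht : t = s
    · subst ht; simp [simpleRoot]
    · simp [simpleRoot, Pi.single_eq_of_ne ht, hzero t ht]
  have h1 := bform_self_of_mem_rootSet h hroot
  rw [hvs, bform_smul_left, bform_smul_right, bform_simpleRoot_self, mul_one] at h1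
  have h2 : v s = 1 := by
    have h3 : 0 ≤ v s := hv0 s
    nlinarith
  rw [hvs, h2, one_smul]

lemma finite_posRoots_map_mem_negRoots (h : IsGeometric cs ρ) (w : W) :
    {v | v ∈ posRoots ρ ∧ ρ w v ∈ negRoots ρ}.Finite := by
  induction w using cs.simple_induction_right with
  | one =>
    refine Set.Finite.subset Set.finite_empty ?_
    rintro v ⟨hv, hn⟩
    exact not_mem_negRoots h hv (by simpa using hn)
  | mul_simple_right w s ih =>
    refine ((ih.image (ρ (cs.simple s))).insert (simpleRoot s)).subset ?_
    rintro v ⟨hv, hn⟩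
    by_cases hs : v = simpleRoot s
    · exact Or.inl hs
    · right
      refine ⟨ρ (cs.simple s) v, ⟨map_simple_mem_posRoots h hv hs, by simpa using hn⟩, ?_⟩
      rw [← LinearEquiv.mul_apply, ← map_mul]
      simp

lemma map_inv_map (w : W) (v : S → ℝ) : ρ w⁻¹ (ρ w v) = v := by
  rw [← LinearEquiv.mul_apply, ← map_mul]
  simp

lemma map_map_inv (w : W) (v : S → ℝ) : ρ w (ρ w⁻¹ v) = v := by
  rw [← LinearEquiv.mul_apply, ← map_mul]
  simp

lemma map_simple_map_simple (s : S) (v : S → ℝ) :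
    ρ (cs.simple s) (ρ (cs.simple s) v) = v := by
  rw [← LinearEquiv.mul_apply, ← map_mul]
  simp

/-- Two positive roots with `B(γ, δ) ≤ -1` have infinitely many roots in their cone. -/
lemma infinite_rootSet_cone (h : IsGeometric cs ρ) {γ δ : S → ℝ} (hγ : γ ∈ posRoots ρ)
    (hδ : δ ∈ posRoots ρ) (hB : bform Mmat γ δ ≤ -1) :
    {z | z ∈ rootSet ρ ∧ ∃ p q : ℝ, 0 ≤ p ∧ 0 ≤ q ∧ z = p • γ + q • δ}.Infinite := by
  have hγr := (mem_posRoots.mp hγ).2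
  have hδr := (mem_posRoots.mp hδ).2
  obtain ⟨a, ha⟩ := exists_isReflIn h hγr
  obtain ⟨b, hb⟩ := exists_isReflIn h hδr
  have hγγ := bform_self_of_mem_rootSet h hγr
  have hδδ := bform_self_of_mem_rootSet h hδr
  have key : ∀ n : ℕ, ∃ p q : ℝ, 0 ≤ p ∧ p + 1 ≤ q ∧ n ≤ q ∧ p • γ + q • δ ∈ rootSet ρ := by
    intro n
    induction n with
    | zero => exact ⟨0, 1, le_rfl, by norm_num, by norm_num, by simpa using hδr⟩
    | succ n ih =>
      obtain ⟨p, q, hp, hpq, hn, hz⟩ := ih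
      set c := -bform Mmat γ δ with hc
      have hc1 : 1 ≤ c := by linarith
      have hp' : q + 1 ≤ 2 * c * q - p := by nlinarith
      have hq' : (2 * c * q - p) + 1 ≤ 2 * c * (2 * c * q - p) - q := by nlinarith
      refine ⟨2 * c * q - p, 2 * c * (2 * c * q - p) - q, by linarith, hq',
        by push_cast; linarith, ?_⟩
      have e : ρ b (ρ a (p • γ + q • δ)) =
          (2 * c * q - p) • γ + (2 * c * (2 * c * q - p) - q) • δ := by
        rw [ha, hb]
        simp only [bform_add_right, bform_sub_right, bform_smul_right, hγγ, hδδ,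
          bform_comm δ γ, show bform Mmat γ δ = -c by rw [hc, neg_neg]]
        module
      exact e ▸ map_mem_rootSet (map_mem_rootSet hz a) b
  refine Set.Infinite.of_image (height S) (Set.infinite_of_not_bddAbove ?_)
  rintro ⟨C, hC⟩
  have hδ0 := height_pos h hδ
  have hγ0 := height_pos h hγ
  obtain ⟨n, hn⟩ := exists_nat_gt (C / height S δ)
  obtain ⟨p, q, hp, hpq, hnq, hz⟩ := key n
  have h1 := hC ⟨_, ⟨hz, p, q, hp, by linarith, rfl⟩, rfl⟩
  rw [map_add, map_smul, map_smul, smul_eq_mul, smul_eq_mul] at h1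
  rw [div_lt_iff₀ hδ0] at hn
  nlinarith [mul_nonneg hp hγ0.le, mul_le_mul_of_nonneg_right hnq hδ0.le]

/-- Positive roots with `B(α, β) ≥ 1` are comparable in the dominance order. -/
lemma dominates_or_dominates (h : IsGeometric cs ρ) {α β : S → ℝ} (hα : α ∈ posRoots ρ)
    (hβ : β ∈ posRoots ρ) (hB : 1 ≤ bform Mmat α β) :
    Dominates ρ α β ∨ Dominates ρ β α := by
  by_contra! hcon
  obtain ⟨h1, h2⟩ := hcon
  simp only [Dominates, not_forall] at h1 h2
  obtain ⟨w, hwβ, hwα⟩ := h1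
  obtain ⟨u, huα, huβ⟩ := h2
  have hαr := (mem_posRoots.mp hα).2
  have hβr := (mem_posRoots.mp hβ).2
  have hwα := (mem_posRoots_or_mem_negRoots h (map_mem_rootSet hαr w)).resolve_right hwα
  have huβ := (mem_posRoots_or_mem_negRoots h (map_mem_rootSet hβr u)).resolve_right huβ
  have hB' : bform Mmat (ρ w α) (-ρ w β) ≤ -1 := by
    rw [bform_neg_right, bform_map h]
    linarith
  refine infinite_rootSet_cone h hwα hwβ hB'
    ((finite_posRoots_map_mem_negRoots h (u * w⁻¹)).subset ?_)
  rintro z ⟨hz, p, q, hp, hq, rfl⟩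
  refine ⟨mem_posRoots.mpr ⟨add_nonneg (smul_nonneg hp (mem_posRoots.mp hwα).1)
    (smul_nonneg hq (mem_posRoots.mp hwβ).1), hz⟩, ?_⟩
  have hzr := neg_mem_rootSet h (map_mem_rootSet hz (u * w⁻¹))
  refine mem_posRoots.mpr ⟨?_, hzr⟩
  have e : -ρ (u * w⁻¹) (p • ρ w α + q • -ρ w β) = p • -ρ u α + q • ρ u β := by
    simp only [map_mul, LinearEquiv.mul_apply, map_add, map_smul, map_neg, map_inv_map]
    module
  rw [e]
  exact add_nonneg (smul_nonneg hp (mem_posRoots.mp huα).1)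
    (smul_nonneg hq (mem_posRoots.mp huβ).1)

/-- A solution of `f (k + 2) = τ f (k + 1) - f k` with `τ < 2` cannot stay positive. -/
lemma not_forall_pos_of_recurrence {τ : ℝ} (hτ : τ < 2) {f : ℕ → ℝ}
    (hf : ∀ k, f (k + 2) = τ * f (k + 1) - f k) : ¬ ∀ k, 0 < f k := by
  intro hpos
  have hdec : ∀ k, f (k + 2) - f (k + 1) ≤ f (k + 1) - f k - (2 - τ) * f (k + 1) := by
    intro k
    rw [hf k]
    linarith
  have hneg : ∃ k, f (k + 1) - f k < 0 := by
    by_contra! hmono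
    have hmono' : ∀ k, f 0 ≤ f k := fun k => by
      induction k with
      | zero => exact le_rfl
      | succ k ih => linarith [hmono k]
    have hlin : ∀ k : ℕ, f (k + 1) - f k ≤ f 1 - f 0 - k * ((2 - τ) * f 0) := by
      intro k
      induction k with
      | zero => simp
      | succ k ih =>
        have h1 := hdec k
        have h2 : (2 - τ) * f 0 ≤ (2 - τ) * f (k + 1) :=
          mul_le_mul_of_nonneg_left (hmono' _) (by linarith)
        push_cast
        linarith
    have hd : 0 < (2 - τ) * f 0 := mul_pos (by linarith) (hpos 0)
    obtain ⟨n, hn⟩ := exists_nat_gt ((f 1 - f 0) / ((2 - τ) * f 0))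
    rw [div_lt_iff₀ hd] at hn
    linarith [hlin n, hmono n]
  obtain ⟨k, hk⟩ := hneg
  have hlin : ∀ n : ℕ, f (k + n + 1) - f (k + n) ≤ f (k + 1) - f k := by
    intro n
    induction n with
    | zero => exact le_rfl
    | succ n ih =>
      have h1 := hdec (k + n)
      have h2 : 0 ≤ (2 - τ) * f (k + n + 1) := mul_nonneg (by linarith) (hpos _).le
      have e : f (k + (n + 1) + 1) - f (k + (n + 1)) = f (k + n + 2) - f (k + n + 1) := rfl
      rw [e]
      linarith
  have hlin' : ∀ n : ℕ, f (k + n) ≤ f k + n * (f (k + 1) - f k) := by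
    intro n
    induction n with
    | zero => simp
    | succ n ih =>
      have h1 := hlin n
      rw [← add_assoc]
      push_cast
      linarith
  obtain ⟨n, hn⟩ := exists_nat_gt (f k / -(f (k + 1) - f k))
  rw [div_lt_iff₀ (by linarith)] at hn
  linarith [hlin' n, hpos (k + n)]

/-- The product of two reflections with `|B(α, β)| < 1` and `B(α, β) ≠ 0` acts with finite order on
the plane spanned by `α` and `β`. -/
lemma exists_pow_map_eq (h : IsGeometric cs ρ) {α β : S → ℝ} (hα : α ∈ rootSet ρ)
    (hB : |bform Mmat α β| < 1) (hB0 : bform Mmat α β ≠ 0) {r : W}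
    (hrα : ρ r α = (4 * bform Mmat α β ^ 2 - 1) • α - (2 * bform Mmat α β) • β)
    (hrβ : ρ r β = (2 * bform Mmat α β) • α - β) :
    ∃ m : ℕ, 0 < m ∧ ρ (r ^ m) α = α ∧ ρ (r ^ m) β = β := by
  set c := bform Mmat α β with hc
  have hc2 : c ^ 2 < 1 := by rw [← sq_abs]; nlinarith [abs_nonneg c]
  have hτ : 4 * c ^ 2 - 2 < 2 := by linarith
  have hrec : ρ (r ^ 2) α = (4 * c ^ 2 - 2) • ρ r α - α := by
    rw [pow_two, map_mul, LinearEquiv.mul_apply]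
    rw [hrα, map_sub, map_smul, map_smul, hrα, hrβ]
    module
  let a : ℕ → ℝ := fun k => height S (ρ (r ^ k) α)
  have harec : ∀ k, a (k + 2) = (4 * c ^ 2 - 2) * a (k + 1) - a k := by
    intro k
    simp only [a]
    rw [pow_add r k 2, pow_succ r k, map_mul, map_mul, LinearEquiv.mul_apply,
      LinearEquiv.mul_apply, hrec]
    simp only [map_sub, map_smul, smul_eq_mul]
  have hroot : ∀ k, ρ (r ^ k) α ∈ rootSet ρ := fun k => map_mem_rootSet hα _
  have hpos_iff : ∀ k, ρ (r ^ k) α ∈ posRoots ρ → 0 < a k := fun k hk => height_pos h hk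
  have hneg_iff : ∀ k, ρ (r ^ k) α ∈ negRoots ρ → 0 < -a k := fun k hk => by
    have := height_pos h (v := -ρ (r ^ k) α) hk
    rwa [map_neg] at this
  have hexpos : ∀ K, ∃ k, K ≤ k ∧ ρ (r ^ k) α ∈ posRoots ρ := by
    intro K
    by_contra! hcon
    refine not_forall_pos_of_recurrence (f := fun k => -a (K + k)) hτ (fun k => ?_) fun k =>
      hneg_iff _ ((mem_posRoots_or_mem_negRoots h (hroot _)).resolve_left
        (hcon _ (Nat.le_add_right K k)))
    have := harec (K + k)
    simp only [← add_assoc] at this ⊢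
    linarith
  have hexneg : ∀ K, ∃ k, K ≤ k ∧ ρ (r ^ k) α ∈ negRoots ρ := by
    intro K
    by_contra! hcon
    refine not_forall_pos_of_recurrence (f := fun k => a (K + k)) hτ (fun k => ?_) fun k =>
      hpos_iff _ ((mem_posRoots_or_mem_negRoots h (hroot _)).resolve_right
        (hcon _ (Nat.le_add_right K k)))
    have := harec (K + k)
    simp only [← add_assoc] at this ⊢
    linarith
  have hcross : ∀ K, ∃ k, K ≤ k ∧ ρ (r ^ k) α ∈ posRoots ρ ∧ ρ r (ρ (r ^ k) α) ∈ negRoots ρ := by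
    intro K
    obtain ⟨k, hKk, hk⟩ := hexpos K
    by_contra! hcon
    have hall : ∀ n, ρ (r ^ (k + n)) α ∈ posRoots ρ := by
      intro n
      induction n with
      | zero => exact hk
      | succ n ih =>
        refine (mem_posRoots_or_mem_negRoots h (hroot _)).resolve_right ?_
        have := hcon (k + n) (by omega) ih
        rwa [← LinearEquiv.mul_apply, ← map_mul, ← pow_succ'] at this
    obtain ⟨l, hkl, hl⟩ := hexneg k
    obtain ⟨n, rfl⟩ := Nat.exists_eq_add_of_le hkl
    exact not_mem_negRoots h (hall n) hl
  choose g hg using hcross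
  have hinf : (Set.range g).Infinite := by
    refine Set.infinite_of_not_bddAbove ?_
    rintro ⟨C, hC⟩
    have h1 := hC ⟨C + 1, rfl⟩
    have h2 := (hg (C + 1)).1
    omega
  obtain ⟨k, -, l, -, hkl, heq⟩ := hinf.exists_ne_map_eq_of_mapsTo
    (f := fun k => ρ (r ^ k) α) (t := {v | v ∈ posRoots ρ ∧ ρ r v ∈ negRoots ρ})
    (by rintro _ ⟨K, rfl⟩; exact (hg K).2) (finite_posRoots_map_mem_negRoots h r)
  have hm : ∃ m : ℕ, 0 < m ∧ ρ (r ^ m) α = α := by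
    wlog hlt : k < l generalizing k l
    · exact this l k hkl.symm heq.symm (by omega)
    refine ⟨l - k, by omega, (ρ (r ^ k)).injective ?_⟩
    rw [← LinearEquiv.mul_apply, ← map_mul, ← pow_add, Nat.add_sub_cancel' hlt.le]
    exact heq.symm
  obtain ⟨m, hm0, hm⟩ := hm
  refine ⟨m, hm0, hm, ?_⟩
  have h1 : ρ (r ^ m) (ρ r α) = ρ r α := by
    rw [← LinearEquiv.mul_apply, ← map_mul, ← pow_succ, pow_succ', map_mul, LinearEquiv.mul_apply,
      hm]
  rw [hrα, map_sub, map_smul, map_smul, hm] at h1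
  have h2 := sub_right_injective h1
  exact smul_right_injective _ (mul_ne_zero two_ne_zero hB0) h2

/-- A functional nonpositive on only finitely many positive roots can be moved into the closed
fundamental chamber. -/
lemma exists_map_simpleRoot_nonneg (h : IsGeometric cs ρ) (y : (S → ℝ) →ₗ[ℝ] ℝ)
    (hy : {v | v ∈ posRoots ρ ∧ y v ≤ 0}.Finite) :
    ∃ w : W, (∀ s, 0 ≤ y (ρ w (simpleRoot s))) ∧
      {v | v ∈ posRoots ρ ∧ y (ρ w v) ≤ 0}.Finite := by
  have hfin : ∀ w : W, {v | v ∈ posRoots ρ ∧ y (ρ w v) ≤ 0}.Finite := by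
    intro w
    refine ((finite_posRoots_map_mem_negRoots h w).union (hy.image (ρ w⁻¹))).subset ?_
    rintro v ⟨hv, hyv⟩
    rcases mem_posRoots_or_mem_negRoots h (map_mem_rootSet (mem_posRoots.mp hv).2 w) with hp | hn
    · exact Or.inr ⟨ρ w v, ⟨hp, hyv⟩, map_inv_map w v⟩
    · exact Or.inl ⟨hv, hn⟩
  let A : W → Set (S → ℝ) := fun w => {v | v ∈ posRoots ρ ∧ y (ρ w v) < 0}
  have hA : ∀ w, (A w).Finite := fun w => (hfin w).subset fun v hv => ⟨hv.1, hv.2.le⟩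
  let w := Function.argmin fun w => (A w).ncard
  refine ⟨w, fun s => ?_, hfin w⟩
  by_contra! hs
  have hmem : simpleRoot s ∈ A w := ⟨simpleRoot_mem_posRoots s, hs⟩
  have hsub : A (w * cs.simple s) ⊆ ρ (cs.simple s) '' (A w \ {simpleRoot s}) := by
    rintro v ⟨hv, hyv⟩
    rw [map_mul, LinearEquiv.mul_apply] at hyv
    have hne : v ≠ simpleRoot s := by
      rintro rfl
      rw [map_simple_simpleRoot h, map_neg, map_neg] at hyv
      linarith
    refine ⟨ρ (cs.simple s) v, ⟨⟨map_simple_mem_posRoots h hv hne, hyv⟩, fun heq => ?_⟩,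
      map_simple_map_simple s v⟩
    have e : v = -simpleRoot s := by
      rw [← map_simple_simpleRoot h, ← Set.mem_singleton_iff.mp heq, map_simple_map_simple]
    refine not_mem_negRoots h hv ?_
    show -v ∈ posRoots ρ
    rw [e, neg_neg]
    exact simpleRoot_mem_posRoots s
  have h1 := Set.ncard_le_ncard hsub (((hA w).sdiff).image _)
  have h2 := Set.ncard_image_le (f := ρ (cs.simple s)) ((hA w).sdiff (t := {simpleRoot s}))
  have h3 := Set.ncard_sdiff_singleton_lt_of_mem hmem (hA w)
  have h4 : (A w).ncard ≤ (A (w * cs.simple s)).ncard :=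
    Function.argmin_le (fun w => (A w).ncard) _
  omega

/-- Only finitely many values in `(-1, 1)` are taken by `B` on pairs of roots. -/
lemma finite_bform_values (h : IsGeometric cs ρ) :
    {c | |c| < 1 ∧ ∃ α ∈ rootSet ρ, ∃ β ∈ rootSet ρ, bform Mmat α β = c}.Finite := by
  let Φ : Set S → Set (S → ℝ) := fun J => {v | v ∈ rootSet ρ ∧ ∀ s, s ∉ J → v s = 0}
  have hfin : (⋃ J ∈ {J : Set S | (Φ J).Finite},
      Set.image2 (bform Mmat) (Φ J) (Φ J)).Finite :=
    Set.Finite.biUnion (Set.toFinite _) fun J hJ => Set.Finite.image2 _ hJ hJ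
  refine (hfin.insert 0).subset ?_
  rintro c ⟨hc1, α, hα, β, hβ, rfl⟩
  by_cases hc0 : bform Mmat α β = 0
  · exact Or.inl hc0
  right
  obtain ⟨a, ha⟩ := exists_isReflIn h hα
  obtain ⟨b, hb⟩ := exists_isReflIn h hβ
  have hαα := bform_self_of_mem_rootSet h hα
  have hββ := bform_self_of_mem_rootSet h hβ
  have hc2 : bform Mmat α β ^ 2 < 1 := by
    rw [← sq_abs]; nlinarith [abs_nonneg (bform Mmat α β)]
  have hrα : ρ (a * b) α =
      (4 * bform Mmat α β ^ 2 - 1) • α - (2 * bform Mmat α β) • β := by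
    rw [map_mul, LinearEquiv.mul_apply, hb, ha]
    simp only [bform_sub_right, bform_smul_right, hαα, bform_comm β α]
    module
  have hrβ : ρ (a * b) β = (2 * bform Mmat α β) • α - β := by
    rw [map_mul, LinearEquiv.mul_apply, hb, ha]
    simp only [bform_sub_right, bform_smul_right, hββ]
    module
  obtain ⟨m, hm0, hmα, hmβ⟩ := exists_pow_map_eq h hα hc1 hc0 hrα hrβ
  let y : (S → ℝ) →ₗ[ℝ] ℝ :=
    ∑ k ∈ Finset.range m, height S ∘ₗ (ρ ((a * b) ^ k) : (S → ℝ) →ₗ[ℝ] (S → ℝ))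
  have hy : ∀ v, y v = ∑ k ∈ Finset.range m, height S (ρ ((a * b) ^ k) v) := by
    intro v
    simp [y]
  have hyr : ∀ v, ρ ((a * b) ^ m) v = v → y (ρ (a * b) v) = y v := by
    intro v hv
    have h1 : ∀ k, height S (ρ ((a * b) ^ k) (ρ (a * b) v)) =
        height S (ρ ((a * b) ^ (k + 1)) v) := fun k => by
      rw [pow_succ, map_mul _ _ (a * b), LinearEquiv.mul_apply]
    rw [hy, hy, Finset.sum_congr rfl fun k _ => h1 k]
    have h2 := Finset.sum_range_succ (fun k => height S (ρ ((a * b) ^ k) v)) m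
    rw [Finset.sum_range_succ', hv] at h2
    simp only [pow_zero, map_one, LinearEquiv.coe_one, id_eq] at h2
    linarith
  have hy1 := hyr α hmα
  have hy2 := hyr β hmβ
  rw [hrα, map_sub, map_smul, map_smul, smul_eq_mul, smul_eq_mul] at hy1
  rw [hrβ, map_sub, map_smul, smul_eq_mul] at hy2
  have hyα : y α = 0 := by
    have : (1 - bform Mmat α β ^ 2) * y α = 0 := by
      linear_combination -hy1 / 2 + bform Mmat α β * hy2 / 2
    exact (mul_eq_zero.mp this).resolve_left (by linarith)
  have hyβ : y β = 0 := by
    rw [hyα] at hy2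
    linarith
  have hyfin : {v | v ∈ posRoots ρ ∧ y v ≤ 0}.Finite := by
    refine (Set.Finite.biUnion (Finset.range m).finite_toSet fun k _ =>
      finite_posRoots_map_mem_negRoots h ((a * b) ^ k)).subset ?_
    rintro v ⟨hv, hyv⟩
    by_contra hcon
    simp only [Set.mem_iUnion, not_exists] at hcon
    refine not_lt.mpr hyv ?_
    rw [hy]
    refine Finset.sum_pos (fun k hk => height_pos h ?_) ⟨0, Finset.mem_range.mpr hm0⟩
    refine (mem_posRoots_or_mem_negRoots h
      (map_mem_rootSet (mem_posRoots.mp hv).2 _)).resolve_right fun hn => ?_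
    exact hcon k hk ⟨hv, hn⟩
  obtain ⟨w, hw0, hwfin⟩ := exists_map_simpleRoot_nonneg h y hyfin
  have hexp : ∀ v : S → ℝ, y (ρ w v) = ∑ s, v s * y (ρ w (simpleRoot s)) := by
    intro v
    have e : v = ∑ s, v s • simpleRoot s := by
      ext t
      simp [simpleRoot, Finset.sum_apply, Pi.single_apply]
    conv_lhs => rw [e]
    simp only [map_sum, map_smul, smul_eq_mul]
  let J : Set S := {s | y (ρ w (simpleRoot s)) = 0}
  have hJpos : ∀ v : S → ℝ, 0 ≤ v → y (ρ w v) = 0 → ∀ s, s ∉ J → v s = 0 := by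
    intro v hv hyv s hs
    rw [hexp, Finset.sum_eq_zero_iff_of_nonneg
      fun t _ => mul_nonneg (hv t) (hw0 t)] at hyv
    exact (mul_eq_zero.mp (hyv s (Finset.mem_univ s))).resolve_right hs
  have hJ : ∀ v ∈ rootSet ρ, y (ρ w v) = 0 → v ∈ Φ J := by
    intro v hv hyv
    refine ⟨hv, fun s hs => ?_⟩
    rcases nonneg_or_nonpos_of_mem_rootSet h hv with h0 | h0
    · exact hJpos v h0 hyv s hs
    · have := hJpos (-v) (neg_nonneg.mpr h0) (by rw [map_neg, map_neg, hyv, neg_zero]) s hs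
      simpa using this
  have hJfin : (Φ J).Finite := by
    refine (hwfin.union (hwfin.image Neg.neg)).subset ?_
    rintro v ⟨hv, hvJ⟩
    have hyv : y (ρ w v) = 0 := by
      rw [hexp]
      refine Finset.sum_eq_zero fun s _ => ?_
      by_cases hs : s ∈ J
      · rw [show y (ρ w (simpleRoot s)) = 0 from hs, mul_zero]
      · rw [hvJ s hs, zero_mul]
    rcases mem_posRoots_or_mem_negRoots h hv with hp | hn
    · exact Or.inl ⟨hp, hyv.le⟩
    · refine Or.inr ⟨-v, ⟨hn, ?_⟩, neg_neg v⟩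
      rw [map_neg, map_neg, hyv, neg_zero]
  refine Set.mem_biUnion (x := J) hJfin ⟨ρ w⁻¹ α, hJ _ (map_mem_rootSet hα _) ?_, ρ w⁻¹ β,
    hJ _ (map_mem_rootSet hβ _) ?_, bform_map h _ _ _⟩
  · rw [map_map_inv, hyα]
  · rw [map_map_inv, hyβ]

lemma Dominates.map {a b : S → ℝ} (hab : Dominates ρ a b) (u : W) :
    Dominates ρ (ρ u a) (ρ u b) := by
  intro w hw
  have := hab (w * u)
  simp only [map_mul, LinearEquiv.mul_apply] at this
  exact this hw

lemma isSmallRoot_simpleRoot (h : IsGeometric cs ρ) (s : S) : IsSmallRoot ρ (simpleRoot s) := by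
  refine ⟨simpleRoot_mem_posRoots s, fun a ha hdom => ?_⟩
  by_contra hne
  refine not_mem_negRoots h (map_simple_mem_posRoots h ha hne) (hdom _ ?_)
  rw [map_simple_simpleRoot h]
  show - -simpleRoot s ∈ posRoots ρ
  rw [neg_neg]
  exact simpleRoot_mem_posRoots s

lemma IsSmallRoot.bform_lt_one (h : IsGeometric cs ρ) {β γ : S → ℝ} (hβ : IsSmallRoot ρ β)
    (hγ : IsSmallRoot ρ γ) (hne : β ≠ γ) : bform Mmat β γ < 1 := by
  by_contra! hB
  rcases dominates_or_dominates h hβ.1 hγ.1 hB with hd | hd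
  · exact hne (hγ.2 _ hβ.1 hd)
  · exact hne (hβ.2 _ hγ.1 hd).symm

lemma IsSmallRoot.map_simple (h : IsGeometric cs ρ) {β : S → ℝ} (hβ : IsSmallRoot ρ β) {s : S}
    (hne : β ≠ simpleRoot s) (hB : 0 < bform Mmat (simpleRoot s) β) :
    IsSmallRoot ρ (ρ (cs.simple s) β) := by
  have hpos := map_simple_mem_posRoots h hβ.1 hne
  refine ⟨hpos, fun a ha hdom => ?_⟩
  by_cases has : a = simpleRoot s
  · exfalso
    subst has
    have hroot := (mem_posRoots.mp hpos).2
    obtain ⟨t, ht⟩ := exists_isReflIn h hroot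
    have h1 := hdom t (by
      show -ρ t _ ∈ posRoots ρ
      rw [ht, bform_self_of_mem_rootSet h hroot]
      convert hpos using 1
      module)
    refine not_mem_negRoots h (mem_posRoots.mpr ⟨?_, ?_⟩) h1
    · have hB' : bform Mmat (ρ (cs.simple s) β) (simpleRoot s) =
          -bform Mmat (simpleRoot s) β := by
        rw [bform_comm, h, bform_sub_right, bform_smul_right, bform_simpleRoot_self]
        ring
      rw [ht, hB', sub_eq_add_neg, ← neg_smul]
      exact add_nonneg (simpleRoot_nonneg s)
        (smul_nonneg (by linarith) (mem_posRoots.mp hpos).1)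
    · exact map_mem_rootSet (simpleRoot_mem_rootSet s) t
  · have h1 := hdom.map (cs.simple s)
    rw [map_simple_map_simple] at h1
    rw [← hβ.2 _ (map_simple_mem_posRoots h ha has) h1, map_simple_map_simple]

/-- `SmallStep cs ρ β β'` holds when `β, β'` are small roots and `β' = s(β)` for some `s ∈ S` with
`-1 < B(α_s, β) < 0`. -/
def SmallStep (cs : CoxeterSystem Mmat W) (ρ : W →* ((S → ℝ) ≃ₗ[ℝ] (S → ℝ)))
    (β β' : S → ℝ) : Prop :=
  IsSmallRoot ρ β ∧ IsSmallRoot ρ β' ∧ ∃ s, -1 < bform Mmat (simpleRoot s) β ∧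
    bform Mmat (simpleRoot s) β < 0 ∧ β' = ρ (cs.simple s) β

lemma SmallStep.height_lt (h : IsGeometric cs ρ) {β β' : S → ℝ} (hs : SmallStep cs ρ β β') :
    height S β < height S β' := by
  obtain ⟨-, -, s, -, hneg, rfl⟩ := hs
  rw [h, map_sub, map_smul, height_simpleRoot, smul_eq_mul]
  linarith

lemma height_lt_of_transGen (h : IsGeometric cs ρ) {β β' : S → ℝ}
    (hp : Relation.TransGen (SmallStep cs ρ) β β') : height S β < height S β' := by
  induction hp with
  | single hs => exact hs.height_lt h
  | tail _ hs ih => exact ih.trans (hs.height_lt h)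

lemma isSmallRoot_of_transGen {β β' : S → ℝ} (hp : Relation.TransGen (SmallStep cs ρ) β β') :
    IsSmallRoot ρ β ∧ IsSmallRoot ρ β' := by
  induction hp with
  | single hs => exact ⟨hs.1, hs.2.1⟩
  | tail _ hs ih => exact ⟨ih.1, hs.2.1⟩

/-- Along a path of small steps, an index `t` with `B(α_t, ·) ≤ -1` is never used again. -/
lemma bform_le_and_apply_eq_of_reflTransGen (h : IsGeometric cs ρ) {β β' : S → ℝ}
    (hp : Relation.ReflTransGen (SmallStep cs ρ) β β') {t : S}
    (ht : bform Mmat (simpleRoot t) β ≤ -1) :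
    bform Mmat (simpleRoot t) β' ≤ -1 ∧ β' t = β t := by
  induction hp with
  | refl => exact ⟨ht, rfl⟩
  | tail _ hs ih =>
    obtain ⟨-, -, s, hgt, hneg, rfl⟩ := hs
    have hst : t ≠ s := by
      rintro rfl
      linarith [ih.1]
    constructor
    · rw [h, bform_sub_right, bform_smul_right]
      nlinarith [ih.1, bform_simpleRoot_nonpos (Mmat := Mmat) hst]
    · rw [h, ← ih.2]
      simp [simpleRoot, Pi.single_eq_of_ne hst]

/-- The vector of the values `B(α_s, β)`, truncated below at `-1`. -/
noncomputable def smallState (Mmat : CoxeterMatrix S) (β : S → ℝ) : S → ℝ :=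
  fun s => max (bform Mmat (simpleRoot s) β) (-1)

lemma smallState_ne_of_transGen (h : IsGeometric cs ρ) {β β' : S → ℝ}
    (hp : Relation.TransGen (SmallStep cs ρ) β β') : smallState Mmat β ≠ smallState Mmat β' := by
  intro heq
  obtain ⟨hβ, hβ'⟩ := isSmallRoot_of_transGen hp
  have hne : β' ≠ β := by
    rintro rfl
    exact lt_irrefl _ (height_lt_of_transGen h hp)
  have hzero : ∀ s, (β' - β) s * bform Mmat (simpleRoot s) (β' - β) = 0 := by
    intro s
    by_cases hs : bform Mmat (simpleRoot s) β ≤ -1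
    · have := (bform_le_and_apply_eq_of_reflTransGen h hp.to_reflTransGen hs).2
      simp [this]
    · have h1 : max (bform Mmat (simpleRoot s) β) (-1) =
          max (bform Mmat (simpleRoot s) β') (-1) := congrFun heq s
      push Not at hs
      rw [max_eq_left hs.le] at h1
      have h2 : bform Mmat (simpleRoot s) β' = bform Mmat (simpleRoot s) β := by
        rcases max_choice (bform Mmat (simpleRoot s) β') (-1) with h3 | h3 <;>
          rw [h3] at h1 <;> linarith
      rw [bform_sub_right, h2, sub_self, mul_zero]
  have hδ : bform Mmat (β' - β) (β' - β) = 0 := by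
    rw [bform_eq_sum]
    exact Finset.sum_eq_zero fun s _ => hzero s
  have h1 := bform_self_of_mem_rootSet h (mem_posRoots.mp hβ.1).2
  have h2 := bform_self_of_mem_rootSet h (mem_posRoots.mp hβ'.1).2
  rw [bform_sub_left, bform_sub_right, bform_sub_right, bform_comm β β', h1, h2] at hδ
  linarith [hβ'.bform_lt_one h hβ hne]

lemma exists_finite_smallState (h : IsGeometric cs ρ) :
    ∃ G : Set (S → ℝ), G.Finite ∧ ∀ β, IsSmallRoot ρ β → smallState Mmat β ∈ G := by
  refine ⟨Set.univ.pi fun _ => insert 1 (insert (-1) {c | |c| < 1 ∧ ∃ α ∈ rootSet ρ,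
    ∃ β ∈ rootSet ρ, bform Mmat α β = c}),
    Set.Finite.pi fun _ => ((finite_bform_values h).insert _).insert _, fun β hβ s _ => ?_⟩
  have hβr := (mem_posRoots.mp hβ.1).2
  by_cases hs : bform Mmat (simpleRoot s) β ≤ -1
  · exact Or.inr (Or.inl (max_eq_right hs))
  push Not at hs
  simp only [smallState, max_eq_left hs.le]
  by_cases hβs : β = simpleRoot s
  · left
    rw [hβs, bform_simpleRoot_self]
  · exact Or.inr (Or.inr ⟨abs_lt.mpr ⟨hs, (isSmallRoot_simpleRoot h s).bform_lt_one h hβ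
      (Ne.symm hβs)⟩, _, simpleRoot_mem_rootSet s, β, hβr, rfl⟩)

/-- Every non-simple small root is the target of a small step. -/
lemma IsSmallRoot.exists_smallStep (h : IsGeometric cs ρ) {β : S → ℝ} (hβ : IsSmallRoot ρ β)
    (hns : ∀ s, β ≠ simpleRoot s) :
    ∃ s, 0 < bform Mmat (simpleRoot s) β ∧ bform Mmat (simpleRoot s) β < 1 ∧
      SmallStep cs ρ (ρ (cs.simple s) β) β := by
  obtain ⟨hβ0, hβr⟩ := mem_posRoots.mp hβ.1
  obtain ⟨s, hs⟩ : ∃ s, 0 < bform Mmat (simpleRoot s) β := by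
    by_contra! hcon
    have h1 := bform_self_of_mem_rootSet h hβr
    rw [bform_eq_sum] at h1
    have : ∑ s, β s * bform Mmat (simpleRoot s) β ≤ 0 :=
      Finset.sum_nonpos fun s _ => mul_nonpos_of_nonneg_of_nonpos (hβ0 s) (hcon s)
    linarith
  have hlt := (isSmallRoot_simpleRoot h s).bform_lt_one h hβ (hns s).symm
  have hB' : bform Mmat (simpleRoot s) (ρ (cs.simple s) β) = -bform Mmat (simpleRoot s) β := by
    rw [h, bform_sub_right, bform_smul_right, bform_simpleRoot_self]
    ring
  exact ⟨s, hs, hlt, hβ.map_simple h (hns s) hs, hβ, s, by linarith, by linarith,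
    (map_simple_map_simple s β).symm⟩

/-- The small roots reached from a simple root by exactly `n` small steps. -/
def smallLayer (cs : CoxeterSystem Mmat W) (ρ : W →* ((S → ℝ) ≃ₗ[ℝ] (S → ℝ))) :
    ℕ → Set (S → ℝ)
  | 0 => Set.range simpleRoot
  | n + 1 => {β' | ∃ β ∈ smallLayer cs ρ n, SmallStep cs ρ β β'}

lemma finite_smallLayer (n : ℕ) : (smallLayer cs ρ n).Finite := by
  induction n with
  | zero => exact Set.finite_range _
  | succ n ih =>
    refine (Set.finite_iUnion fun s => ih.image (ρ (cs.simple s))).subset ?_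
    rintro _ ⟨β, hβ, -, -, s, -, -, rfl⟩
    exact Set.mem_iUnion.mpr ⟨s, β, hβ, rfl⟩

lemma IsSmallRoot.exists_mem_smallLayer (h : IsGeometric cs ρ) {β : S → ℝ}
    (hβ : IsSmallRoot ρ β) : ∃ n, β ∈ smallLayer cs ρ n := by
  obtain ⟨ε, hε, hmin⟩ : ∃ ε : ℝ, 0 < ε ∧ ∀ c : ℝ, 0 < c → c < 1 →
      (∃ α ∈ rootSet ρ, ∃ β ∈ rootSet ρ, bform Mmat α β = c) → ε ≤ c := by
    have hfin := (finite_bform_values h).inter_of_left (Set.Ioi 0)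
    set F := {c | |c| < 1 ∧ ∃ α ∈ rootSet ρ, ∃ β ∈ rootSet ρ, bform Mmat α β = c} ∩ Set.Ioi 0
    have hF : ∀ c : ℝ, 0 < c → c < 1 →
        (∃ α ∈ rootSet ρ, ∃ β ∈ rootSet ρ, bform Mmat α β = c) → c ∈ F :=
      fun c hc0 hc1 hc => ⟨⟨abs_lt.mpr ⟨by linarith, hc1⟩, hc⟩, hc0⟩
    rcases F.eq_empty_or_nonempty with hemp | hne
    · refine ⟨1, one_pos, fun c hc0 hc1 hc => ?_⟩
      exact absurd (hF c hc0 hc1 hc) (hemp ▸ Set.notMem_empty c)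
    · obtain ⟨ε, hε, hle⟩ := Set.exists_min_image _ id hfin hne
      exact ⟨ε, hε.2, fun c hc0 hc1 hc => hle c (hF c hc0 hc1 hc)⟩
  obtain ⟨N, hN⟩ := exists_nat_gt (height S β / ε)
  rw [div_lt_iff₀ hε] at hN
  induction N generalizing β with
  | zero =>
    have := height_pos h hβ.1
    simp only [CharP.cast_eq_zero, zero_mul] at hN
    linarith
  | succ N ih =>
    by_cases hs : ∃ s, β = simpleRoot s
    · obtain ⟨s, rfl⟩ := hs
      exact ⟨0, s, rfl⟩
    push Not at hs
    obtain ⟨s, h0, h1, hstep⟩ := hβ.exists_smallStep h hs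
    have hle := hmin _ h0 h1 ⟨_, simpleRoot_mem_rootSet s, β, (mem_posRoots.mp hβ.1).2, rfl⟩
    obtain ⟨n, hn⟩ := ih hstep.1 (by
      rw [h, map_sub, map_smul, height_simpleRoot, smul_eq_mul]
      push_cast at hN
      linarith)
    exact ⟨n + 1, _, hn, hstep⟩

lemma exists_finset_smallState (h : IsGeometric cs ρ) {n : ℕ} {β : S → ℝ}
    (hβ : β ∈ smallLayer cs ρ n) :
    ∃ T : Finset (S → ℝ), T.card = n + 1 ∧ ∀ x ∈ T, ∃ γ, IsSmallRoot ρ γ ∧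
      Relation.ReflTransGen (SmallStep cs ρ) γ β ∧ smallState Mmat γ = x := by
  classical
  induction n generalizing β with
  | zero =>
    obtain ⟨s, rfl⟩ := hβ
    refine ⟨{smallState Mmat (simpleRoot s)}, by simp, fun x hx => ?_⟩
    exact ⟨_, isSmallRoot_simpleRoot h s, .refl, (Finset.mem_singleton.mp hx).symm⟩
  | succ n ih =>
    obtain ⟨β₀, hβ₀, hstep⟩ := hβ
    obtain ⟨T, hcard, hT⟩ := ih hβ₀
    refine ⟨insert (smallState Mmat β) T, ?_, fun x hx => ?_⟩
    · rw [Finset.card_insert_of_notMem, hcard]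
      intro hmem
      obtain ⟨γ, -, hγ, heq⟩ := hT _ hmem
      exact smallState_ne_of_transGen h (.tail' hγ hstep) heq
    · rcases Finset.mem_insert.mp hx with rfl | hx
      · exact ⟨β, hstep.2.1, .refl, rfl⟩
      · obtain ⟨γ, hγs, hγ, heq⟩ := hT x hx
        exact ⟨γ, hγs, hγ.tail hstep, heq⟩

end GeometricRepresentation

/-- **Theorem 4.3 (Brink–Howlett).** For every Coxeter system `(W, S)` with `S` finite,
the set `Σ` of small roots is finite. -/
theorem smallRoots_finite {S : Type*} [Fintype S] [DecidableEq S]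
    (Mmat : CoxeterMatrix S) {W : Type*} [Group W] (cs : CoxeterSystem Mmat W)
    (ρ : W →* ((S → ℝ) ≃ₗ[ℝ] (S → ℝ)))
    (hfaith : Function.Injective ρ)
    (hρ : ∀ (s : S) (v : S → ℝ),
      ρ (cs.simple s) v = v - (2 * bform Mmat (simpleRoot s) v) • simpleRoot s) :
    {b : S → ℝ | IsSmallRoot ρ b}.Finite := by
  have h : IsGeometric cs ρ := hρ
  obtain ⟨G, hG, hmem⟩ := exists_finite_smallState h
  refine (Set.Finite.biUnion (Set.finite_lt_nat G.ncard) fun n _ =>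
    finite_smallLayer (cs := cs) (ρ := ρ) n).subset fun β hβ => ?_
  obtain ⟨n, hn⟩ := IsSmallRoot.exists_mem_smallLayer h hβ
  refine Set.mem_biUnion (show n < G.ncard from ?_) hn
  obtain ⟨T, hcard, hT⟩ := exists_finset_smallState h hn
  have hTG : (T : Set (S → ℝ)) ⊆ G := by
    intro x hx
    obtain ⟨γ, hγ, -, rfl⟩ := hT x hx
    exact hmem γ hγ
  have := Set.ncard_le_ncard hTG hG
  rw [Set.ncard_coe_finset, hcard] at this
  omega
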